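/- arXiv:2003.00727 — 2 statements merged into one kernel-verified Lean document; each statement's English description precedes it below -/
import Mathlib

section
/- Let Z be a Brown–Resnick stationary random field with values in E satisfying E[Z(t)] = 1 for all t ∈ ℤ^d, and let H_Z = lim_{n→∞} n^{−d} E[max_{t ∈ {0,1,…,n}^d} Z(t)]. Then for any sequences of positive integers r_{n,1}, …, r_{n,d} (n ≥ 1), each non-decreasing in n and tending to ∞, one has lim_{n→∞} (∏_{j=1}^d r_{n,j})^{−1} · E[max{ Z(i) : i ∈ ℤ^d, 0 ≤ i_j ≤ r_{n,j} for all j ≤ d }] = H_Z. (Hence the classical extremal index of the associated stationary max-stable field equals its block extremal index.) -/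
open MeasureTheory ENNReal Filter
open scoped NNReal ENNReal

/-- Index set `ℤ^d`. -/
abbrev Idx (d : ℕ) := Fin d → ℤ

/-- The space `E = [0,∞)^{ℤ^d}` (with the product σ-field). -/
abbrev Fld (d : ℕ) := Idx d → ℝ≥0

/-- The shift `B^h`, acting by `(B^h f)(t) = f (t - h)`. -/
def shift {d : ℕ} (h : Idx d) (f : Fld d) : Fld d := fun t => f (t - h)

/-- `F : E → [0,∞]` is 0-homogeneous if `F (c • f) = F f` for all `c > 0`. -/
def Homog0 {d : ℕ} (F : Fld d → ℝ≥0∞) : Prop :=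
  ∀ c : ℝ≥0, 0 < c → ∀ f : Fld d, F (fun t => c * f t) = F f

/-- `Z` is a Brown–Resnick stationary random field with unit means: it is measurable,
`E[Z(t)] = 1` for all `t`, and `E[Z(h) F(Z)] = E[Z(0) F(B^h Z)]` for every measurable
0-homogeneous `F : E → [0,∞]`. -/
structure IsBRS {d : ℕ} {Ω : Type*} [MeasurableSpace Ω] (P : Measure Ω)
    (Z : Ω → Fld d) : Prop where
  meas : Measurable Z
  mean_one : ∀ t : Idx d, ∫⁻ ω, (Z ω t : ℝ≥0∞) ∂P = 1
  tilt_shift : ∀ (h : Idx d) (F : Fld d → ℝ≥0∞), Measurable F → Homog0 F →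
    ∫⁻ ω, (Z ω h : ℝ≥0∞) * F (Z ω) ∂P = ∫⁻ ω, (Z ω 0 : ℝ≥0∞) * F (shift h (Z ω)) ∂P

/-- The discrete cube `{0,1,…,n}^d ⊆ ℤ^d`. -/
def cube (d n : ℕ) : Set (Idx d) := {t | ∀ j, 0 ≤ t j ∧ t j ≤ (n : ℤ)}

/-- `E[max_{t ∈ {0,…,n}^d} Z(t)]`. -/
noncomputable def cubeMaxExp {d : ℕ} {Ω : Type*} [MeasurableSpace Ω] (P : Measure Ω)
    (Z : Ω → Fld d) (n : ℕ) : ℝ≥0∞ :=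
  ∫⁻ ω, ⨆ t ∈ cube d n, (Z ω t : ℝ≥0∞) ∂P

/-- `max_S f / sum_S f`. -/
noncomputable def ratioG {d : ℕ} (S : Finset (Idx d)) (f : Fld d) : ℝ≥0∞ :=
  (⨆ t ∈ S, (f t : ℝ≥0∞)) / ∑ t ∈ S, (f t : ℝ≥0∞)

lemma ratioG_meas {d : ℕ} (S : Finset (Idx d)) : Measurable (ratioG S) := by
  unfold ratioG
  refine Measurable.div ?_ ?_
  · exact Measurable.iSup fun t => Measurable.iSup fun _ =>
      (measurable_pi_apply t).coe_nnreal_ennreal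
  · exact Finset.measurable_sum _ fun t _ => (measurable_pi_apply t).coe_nnreal_ennreal

lemma ratioG_homog {d : ℕ} (S : Finset (Idx d)) : Homog0 (ratioG S) := by
  intro c hc f
  unfold ratioG
  simp only [ENNReal.coe_mul]
  simp only [← ENNReal.mul_iSup, ← Finset.mul_sum]
  exact ENNReal.mul_div_mul_left _ _ (by simpa using hc.ne') ENNReal.coe_ne_top

lemma sup_eq_ratioG {d : ℕ} (S : Finset (Idx d)) (f : Fld d) :
    (⨆ t ∈ S, (f t : ℝ≥0∞)) = ∑ h ∈ S, (f h : ℝ≥0∞) * ratioG S f := by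
  rw [← Finset.sum_mul]
  unfold ratioG
  by_cases h0 : (∑ t ∈ S, (f t : ℝ≥0∞)) = 0
  · rw [h0, zero_mul]
    rw [Finset.sum_eq_zero_iff] at h0
    simpa using h0
  · refine (ENNReal.mul_div_cancel h0 ?_).symm
    exact (ENNReal.sum_lt_top.2 fun t _ => ENNReal.coe_lt_top).ne

lemma sup_shift {d : ℕ} {Ω : Type*} [MeasurableSpace Ω] (P : Measure Ω)
    (Z : Ω → Fld d) (hZ : IsBRS P Z) (S : Finset (Idx d)) (u : Idx d) :
    ∫⁻ ω, ⨆ t ∈ S, (Z ω (t + u) : ℝ≥0∞) ∂P = ∫⁻ ω, ⨆ t ∈ S, (Z ω t : ℝ≥0∞) ∂P := by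
  have mZ : ∀ t, Measurable fun ω => (Z ω t : ℝ≥0∞) := fun t =>
    ((measurable_pi_apply t).comp hZ.meas).coe_nnreal_ennreal
  have msh : Measurable (shift (-u) : Fld d → Fld d) :=
    measurable_pi_lambda _ fun t => measurable_pi_apply _
  have mG := ratioG_meas S
  have e1 : ∀ ω, (⨆ t ∈ S, (Z ω (t + u) : ℝ≥0∞)) =
      ∑ h ∈ S, (Z ω (h + u) : ℝ≥0∞) * ratioG S (shift (-u) (Z ω)) := by
    intro ω
    have := sup_eq_ratioG S (shift (-u) (Z ω))
    simpa only [shift, sub_neg_eq_add] using this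
  simp_rw [e1, sup_eq_ratioG S]
  have f1 : ∀ h ∈ S, Measurable fun ω =>
      (Z ω (h + u) : ℝ≥0∞) * ratioG S (shift (-u) (Z ω)) :=
    fun h _ => (mZ _).mul (mG.comp (msh.comp hZ.meas))
  have f2 : ∀ h ∈ S, Measurable fun ω => (Z ω h : ℝ≥0∞) * ratioG S (Z ω) :=
    fun h _ => (mZ _).mul (mG.comp hZ.meas)
  rw [lintegral_finsetSum _ f1, lintegral_finsetSum _ f2]
  refine Finset.sum_congr rfl fun h _ => ?_
  rw [hZ.tilt_shift h _ mG (ratioG_homog S),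
    hZ.tilt_shift (h + u) (fun f => ratioG S (shift (-u) f)) (mG.comp msh)
      (fun c hc f => ratioG_homog S c hc (shift (-u) f))]
  refine lintegral_congr fun ω => ?_
  congr 2
  funext t
  simp only [shift]
  congr 1
  abel

/-- Expected maximum over the box. -/
noncomputable def boxExp {d : ℕ} {Ω : Type*} [MeasurableSpace Ω] (P : Measure Ω)
    (Z : Ω → Fld d) (r : Fin d → ℕ) : ℝ≥0∞ :=
  ∫⁻ ω, ⨆ i ∈ {i : Idx d | ∀ j, 0 ≤ i j ∧ i j ≤ (r j : ℤ)}, (Z ω i : ℝ≥0∞) ∂P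

lemma box_cover {d : ℕ} {Ω : Type*} [MeasurableSpace Ω] (P : Measure Ω)
    (Z : Ω → Fld d) (hZ : IsBRS P Z) (r s : Fin d → ℕ) (hs : ∀ j, 0 < s j) :
    boxExp P Z r ≤ (∏ j, ((r j / s j : ℕ) + 1 : ℝ≥0∞)) * boxExp P Z s := by
  set S : Finset (Idx d) := Fintype.piFinset fun j => Finset.Icc 0 (s j : ℤ) with hS
  set K : Finset (Fin d → ℕ) := Fintype.piFinset fun j => Finset.range (r j / s j + 1) with hK
  have mZ : ∀ t, Measurable fun ω => (Z ω t : ℝ≥0∞) := fun t =>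
    ((measurable_pi_apply t).comp hZ.meas).coe_nnreal_ennreal
  have hb : boxExp P Z s = ∫⁻ ω, ⨆ t ∈ S, (Z ω t : ℝ≥0∞) ∂P := by
    unfold boxExp
    simp [hS]
  have hcard : (∏ j, ((r j / s j : ℕ) + 1 : ℝ≥0∞)) = (K.card : ℝ≥0∞) := by
    simp [hK, Fintype.card_piFinset]
  calc boxExp P Z r
      ≤ ∫⁻ ω, ∑ k ∈ K, ⨆ t ∈ S, (Z ω (t + fun j => (k j * s j : ℤ)) : ℝ≥0∞) ∂P := by
        refine lintegral_mono fun ω => iSup₂_le fun i hi => ?_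
        have hi' : ∀ j, 0 ≤ i j ∧ i j ≤ (r j : ℤ) := hi
        let k : Fin d → ℕ := fun j => (i j).toNat / s j
        let t : Idx d := fun j => (((i j).toNat % s j : ℕ) : ℤ)
        have hk : k ∈ K := by
          simp only [hK, Fintype.mem_piFinset, Finset.mem_range, k]
          intro j
          have h1 : (i j).toNat ≤ r j := by have := hi' j; omega
          exact Nat.lt_succ_of_le (Nat.div_le_div_right h1)
        have ht : t ∈ S := by
          simp only [hS, Fintype.mem_piFinset, Finset.mem_Icc, t]
          intro j
          have := Nat.mod_lt (i j).toNat (hs j)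
          omega
        have hit : i = t + fun j => (k j * s j : ℤ) := by
          funext j
          have h2 := Nat.mod_add_div' (i j).toNat (s j)
          have h3 := (hi' j).1
          have h4 : (((i j).toNat : ℕ) : ℤ) = i j := Int.toNat_of_nonneg h3
          simp only [Pi.add_apply, t, k]
          rw [← h4]
          exact_mod_cast h2.symm
        refine le_trans ?_ (Finset.single_le_sum
          (f := fun k : Fin d → ℕ => ⨆ t ∈ S, (Z ω (t + fun j => (k j * s j : ℤ)) : ℝ≥0∞))
          (fun _ _ => zero_le) hk)
        conv_lhs => rw [hit]
        exact le_iSup₂ (f := fun t (_ : t ∈ S) => (Z ω (t + fun j => (k j * s j : ℤ)) : ℝ≥0∞)) t ht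
    _ = ∑ k ∈ K, boxExp P Z s := by
        rw [lintegral_finsetSum]
        · refine Finset.sum_congr rfl fun k _ => ?_
          rw [hb]
          exact sup_shift P Z hZ S _
        · exact fun k _ => Measurable.iSup fun t => Measurable.iSup fun _ => mZ _
    _ = _ := by rw [hcard, Finset.sum_const, nsmul_eq_mul]

lemma box_ineq {d : ℕ} {Ω : Type*} [MeasurableSpace Ω] (P : Measure Ω)
    (Z : Ω → Fld d) (hZ : IsBRS P Z) (r s : Fin d → ℕ) (hr : ∀ j, 0 < r j) (hs : ∀ j, 0 < s j) :
    boxExp P Z r / ∏ j, (r j : ℝ≥0∞) ≤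
      (∏ j, ((s j : ℝ≥0∞)⁻¹ + (r j : ℝ≥0∞)⁻¹)) * boxExp P Z s := by
  have hr0 : ∀ j, (r j : ℝ≥0∞) ≠ 0 := fun j => by exact_mod_cast (hr j).ne'
  have hs0 : ∀ j, (s j : ℝ≥0∞) ≠ 0 := fun j => by exact_mod_cast (hs j).ne'
  refine ENNReal.div_le_of_le_mul ((box_cover P Z hZ r s hs).trans ?_)
  rw [mul_right_comm, ← Finset.prod_mul_distrib]
  gcongr with j
  rw [add_mul, ENNReal.inv_mul_cancel (hr0 j) (ENNReal.natCast_ne_top _)]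
  gcongr
  rw [mul_comm, ← div_eq_mul_inv, ENNReal.le_div_iff_mul_le (Or.inl (hs0 j))
    (Or.inl (ENNReal.natCast_ne_top _))]
  exact_mod_cast Nat.div_mul_le_self _ _

lemma prod_tendsto {d : ℕ} (s : Fin d → ℕ) (hs : ∀ j, 0 < s j) (r : ℕ → Fin d → ℕ)
    (hinf : ∀ j, Tendsto (fun n => r n j) atTop atTop) (a : ℝ≥0∞) :
    Tendsto (fun n => (∏ j, ((s j : ℝ≥0∞)⁻¹ + (r n j : ℝ≥0∞)⁻¹)) * a) atTop
      (nhds (a / ∏ j, (s j : ℝ≥0∞))) := by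
  have hinv : (∏ j, (s j : ℝ≥0∞))⁻¹ = ∏ j, (s j : ℝ≥0∞)⁻¹ :=
    (ENNReal.prod_inv_distrib (fun i _ j _ _ => Or.inr (ENNReal.natCast_ne_top _)))
  rw [div_eq_mul_inv, mul_comm, hinv]
  refine ENNReal.Tendsto.mul_const ?_ (Or.inl ?_)
  · refine ENNReal.tendsto_finsetProd_of_ne_top _ (fun j _ => ?_) (fun j _ => ?_)
    · have := (ENNReal.tendsto_inv_nat_nhds_zero.comp (hinf j)).const_add ((s j : ℝ≥0∞)⁻¹)
      simpa using this
    · simpa using (hs j).ne'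
  · exact Finset.prod_ne_zero_iff.2 fun j _ => by simp

/-- If `H_Z` is the (cubic) Pickands constant of a Brown–Resnick
stationary field `Z` with `E[Z(t)]=1`, then for arbitrary coordinatewise non-decreasing
sequences of positive integers `r n j → ∞`, the block maxima
`E[max{Z(i) : 0 ≤ i_j ≤ r n j}] / ∏_j r n j` converge to `H_Z` as well; hence the
classical extremal index coincides with the block extremal index. -/
theorem stmt1 {d : ℕ} (hd : 0 < d) {Ω : Type*} [MeasurableSpace Ω] (P : Measure Ω)
    [IsProbabilityMeasure P] (Z : Ω → Fld d) (hZ : IsBRS P Z) (H : ℝ≥0∞)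
    (hH : Tendsto (fun n : ℕ => cubeMaxExp P Z n / (n : ℝ≥0∞) ^ d) atTop (nhds H))
    (r : ℕ → Fin d → ℕ)
    (hpos : ∀ n j, 0 < r n j)
    (hmono : ∀ j, Monotone fun n => r n j)
    (hinf : ∀ j, Tendsto (fun n => r n j) atTop atTop) :
    Tendsto
      (fun n : ℕ =>
        (∫⁻ ω, ⨆ i ∈ {i : Idx d | ∀ j, 0 ≤ i j ∧ i j ≤ (r n j : ℤ)}, (Z ω i : ℝ≥0∞) ∂P) /
          ∏ j : Fin d, (r n j : ℝ≥0∞))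
      atTop (nhds H) := by
  have hcube : ∀ n, cubeMaxExp P Z n = boxExp P Z (fun _ => n) := fun n => rfl
  have hlow : ∀ n, H ≤ boxExp P Z (r n) / ∏ j, (r n j : ℝ≥0∞) := by
    intro n
    refine le_of_tendsto_of_tendsto hH
      (prod_tendsto (r n) (hpos n) (fun m _ => m) (fun _ => tendsto_id) (boxExp P Z (r n))) ?_
    filter_upwards [eventually_gt_atTop 0] with m hm
    have := box_ineq P Z hZ (fun _ => m) (r n) (fun _ => hm) (hpos n)
    simpa [hcube] using this
  refine tendsto_order.2 ⟨fun b hb => Eventually.of_forall fun n => hb.trans_le (hlow n), ?_⟩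
  intro b hb
  obtain ⟨m, hmb, hm⟩ := ((hH.eventually_lt_const hb).and (eventually_gt_atTop 0)).exists
  have ht := prod_tendsto (fun _ : Fin d => m) (fun _ => hm) r hinf (boxExp P Z (fun _ => m))
  have hmb' : boxExp P Z (fun _ => m) / ∏ _j : Fin d, (m : ℝ≥0∞) < b := by
    simpa [hcube] using hmb
  filter_upwards [ht.eventually_lt_const hmb'] with n hn
  exact (box_ineq P Z hZ (r n) (fun _ => m) (hpos n) (fun _ => hm)).trans_lt hn
end

section
/- Let Z be a Brown–Resnick stationary random field with values in E satisfying E[Z(t)] = 1 for all t ∈ ℤ^d, max_{t∈ℤ^d} Z(t) > 0 almost surely, and P(Σ_{t∈ℤ^d} Z(t) < ∞) > 0. Then the classical extremal index H_Z = lim_{n→∞} n^{−d} E[max_{t∈{0,…,n}^d} Z(t)] satisfies H_Z = E[ Z(0) · (max_{t∈ℤ^d} Z(t) / Σ_{t∈ℤ^d} Z(t)) · 1{Σ_{t∈ℤ^d} Z(t) < ∞} ]. -/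
open MeasureTheory ENNReal Filter
open scoped NNReal ENNReal

noncomputable section Aux

open Classical

def cubeF (d n : ℕ) : Finset (Idx d) := Finset.Icc (fun _ => 0) (fun _ => (n : ℤ))

def subF {d : ℕ} (C : Finset (Idx d)) (h : Idx d) : Finset (Idx d) :=
  C.map (Equiv.subRight h).toEmbedding

def Mx {d : ℕ} (f : Fld d) : ℝ≥0∞ := ⨆ t, (f t : ℝ≥0∞)

def mC {d : ℕ} (C : Finset (Idx d)) (f : Fld d) : ℝ≥0∞ := C.sup (fun t => (f t : ℝ≥0∞))

def sC {d : ℕ} (C : Finset (Idx d)) (f : Fld d) : ℝ≥0∞ := ∑ t ∈ C, (f t : ℝ≥0∞)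

def F1 {d : ℕ} (C : Finset (Idx d)) (f : Fld d) : ℝ≥0∞ :=
  if Mx f < ∞ then mC C f / sC C f else 0

def F2 {d : ℕ} (C : Finset (Idx d)) (h : Idx d) (f : Fld d) : ℝ≥0∞ :=
  if Mx f = ∞ ∧ ∀ t ∈ C, f t ≤ f h then 1 else 0

lemma mem_cubeF {d n : ℕ} (t : Idx d) : t ∈ cubeF d n ↔ t ∈ cube d n := by
  simp [cubeF, cube, Finset.mem_Icc, Pi.le_def, forall_and]

lemma mem_subF {d : ℕ} (C : Finset (Idx d)) (h s : Idx d) : s ∈ subF C h ↔ s + h ∈ C := by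
  simp only [subF, Finset.mem_map_equiv]
  simp

lemma card_box (d : ℕ) (a b : ℤ) :
    (Finset.Icc (fun _ : Fin d => a) (fun _ => b)).card = (b + 1 - a).toNat ^ d := by
  rw [Pi.card_Icc]; simp

lemma Mx_mul {d : ℕ} (c : ℝ≥0) (f : Fld d) : Mx (fun t => c * f t) = c * Mx f := by
  simp [Mx, ENNReal.mul_iSup]

lemma mC_mul {d : ℕ} (C : Finset (Idx d)) (c : ℝ≥0) (f : Fld d) :
    mC C (fun t => c * f t) = c * mC C f := by
  simp [mC, Finset.sup_eq_iSup, ENNReal.mul_iSup]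

lemma sC_mul {d : ℕ} (C : Finset (Idx d)) (c : ℝ≥0) (f : Fld d) :
    sC C (fun t => c * f t) = c * sC C f := by
  simp [sC, Finset.mul_sum]

lemma Mx_shift {d : ℕ} (h : Idx d) (f : Fld d) : Mx (shift h f) = Mx f := by
  unfold Mx shift
  exact (Equiv.subRight h).iSup_comp (g := fun t => (f t : ℝ≥0∞))

lemma mC_shift {d : ℕ} (C : Finset (Idx d)) (h : Idx d) (f : Fld d) :
    mC C (shift h f) = mC (subF C h) f := by
  simp [mC, subF, shift, Finset.sup_map, Function.comp_def]

lemma sC_shift {d : ℕ} (C : Finset (Idx d)) (h : Idx d) (f : Fld d) :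
    sC C (shift h f) = sC (subF C h) f := by
  simp [sC, subF, shift]

lemma F1_shift {d : ℕ} (C : Finset (Idx d)) (h : Idx d) (f : Fld d) :
    F1 C (shift h f) = F1 (subF C h) f := by
  simp only [F1, Mx_shift, mC_shift, sC_shift]

lemma F2_shift {d : ℕ} (C : Finset (Idx d)) (h : Idx d) (f : Fld d) :
    F2 C h (shift h f) = F2 (subF C h) 0 f := by
  have : (∀ t ∈ C, shift h f t ≤ shift h f h) ↔ (∀ t ∈ subF C h, f t ≤ f 0) := by
    simp only [shift, sub_self]
    constructor
    · intro H t ht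
      have := H _ ((mem_subF C h t).1 ht)
      simpa using this
    · intro H t ht
      exact H _ ((mem_subF C h _).2 (by simpa using ht))
  simp only [F2, Mx_shift, this]

lemma mul_lt_top_iff' {c : ℝ≥0} (hc : 0 < c) (x : ℝ≥0∞) : (c : ℝ≥0∞) * x = ∞ ↔ x = ∞ := by
  constructor
  · intro h
    by_contra hx
    exact ENNReal.mul_ne_top ENNReal.coe_ne_top hx h
  · rintro rfl
    exact ENNReal.mul_top (by simpa using hc.ne')

lemma F1_homog {d : ℕ} (C : Finset (Idx d)) : Homog0 (F1 C) := by
  intro c hc f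
  simp only [F1, Mx_mul, mC_mul, sC_mul, lt_top_iff_ne_top, ne_eq, mul_lt_top_iff' hc]
  rw [ENNReal.mul_div_mul_left _ _ (by simpa using hc.ne') ENNReal.coe_ne_top]

lemma F2_homog {d : ℕ} (C : Finset (Idx d)) (h : Idx d) : Homog0 (F2 C h) := by
  intro c hc f
  have (t : Idx d) : c * f t ≤ c * f h ↔ f t ≤ f h := mul_le_mul_iff_right₀ hc
  simp only [F2, Mx_mul, mul_lt_top_iff' hc, this]

lemma meas_coe {d : ℕ} (t : Idx d) : Measurable (fun f : Fld d => (f t : ℝ≥0∞)) :=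
  (measurable_pi_apply t).coe_nnreal_ennreal

lemma meas_Mx {d : ℕ} : Measurable (Mx (d := d)) := by
  unfold Mx
  exact Measurable.iSup fun t => meas_coe t

lemma meas_mC {d : ℕ} (C : Finset (Idx d)) : Measurable (mC C) := by
  have : mC C = fun f : Fld d => ⨆ t ∈ C, (f t : ℝ≥0∞) := by
    funext f; simp [mC, Finset.sup_eq_iSup]
  rw [this]
  exact Measurable.iSup fun t => Measurable.iSup fun _ => meas_coe t

lemma meas_sC {d : ℕ} (C : Finset (Idx d)) : Measurable (sC C) := by
  unfold sC
  exact Finset.measurable_fun_sum _ fun t _ => meas_coe t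

lemma meas_F1 {d : ℕ} (C : Finset (Idx d)) : Measurable (F1 C) := by
  unfold F1
  exact Measurable.ite (measurableSet_lt meas_Mx measurable_const)
    ((meas_mC C).div (meas_sC C)) measurable_const

lemma meas_F2 {d : ℕ} (C : Finset (Idx d)) (h : Idx d) : Measurable (F2 C h) := by
  unfold F2
  refine Measurable.ite ?_ measurable_const measurable_const
  refine MeasurableSet.inter (measurableSet_eq_fun meas_Mx measurable_const) ?_
  have : {f : Fld d | ∀ t ∈ C, f t ≤ f h} = ⋂ t ∈ C, {f : Fld d | f t ≤ f h} := by
    ext; simp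
  change MeasurableSet {f : Fld d | ∀ t ∈ C, f t ≤ f h}
  rw [this]
  exact Finset.measurableSet_biInter _ fun t _ =>
    measurableSet_le (measurable_pi_apply t) (measurable_pi_apply h)

lemma mC_le_sC {d : ℕ} (C : Finset (Idx d)) (f : Fld d) : mC C f ≤ sC C f :=
  Finset.sup_le fun t ht => Finset.single_le_sum (f := fun t => (f t : ℝ≥0∞)) (by simp) ht

lemma F1_le {d : ℕ} (C : Finset (Idx d)) (f : Fld d) : F1 C f ≤ 1 := by
  unfold F1
  split_ifs
  · exact ENNReal.div_le_of_le_mul (by simpa using mC_le_sC C f)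
  · simp

lemma F2_le {d : ℕ} (C : Finset (Idx d)) (h : Idx d) (f : Fld d) : F2 C h f ≤ 1 := by
  unfold F2
  split_ifs <;> simp

lemma sum_F1 {d : ℕ} (C : Finset (Idx d)) (f : Fld d) :
    ∑ h ∈ C, (f h : ℝ≥0∞) * F1 C f = if Mx f < ∞ then mC C f else 0 := by
  rw [← Finset.sum_mul]
  change sC C f * F1 C f = _
  unfold F1
  split_ifs
  · refine ENNReal.mul_div_cancel' (fun h => ?_) (fun h => ?_)
    · exact le_antisymm (h ▸ mC_le_sC C f) bot_le
    · exact absurd h (by simp [sC])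
  · simp

lemma sum_F2 {d : ℕ} (C : Finset (Idx d)) (hC : C.Nonempty) (f : Fld d) :
    (if Mx f < ∞ then 0 else mC C f) ≤ ∑ h ∈ C, (f h : ℝ≥0∞) * F2 C h f := by
  split_ifs with hM
  · simp
  · obtain ⟨t, ht, hmax⟩ := C.exists_max_image (fun t => f t) hC
    have h1 : F2 C t f = 1 := by
      unfold F2
      rw [if_pos ⟨by simpa using hM, hmax⟩]
    calc mC C f ≤ (f t : ℝ≥0∞) := Finset.sup_le fun s hs => by exact_mod_cast hmax s hs
      _ = (f t : ℝ≥0∞) * F2 C t f := by rw [h1, mul_one]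
      _ ≤ _ := Finset.single_le_sum (f := fun h => (f h : ℝ≥0∞) * F2 C h f) (by simp) ht

lemma tendsto_F1 {d : ℕ} (f : Fld d) :
    Tendsto (fun C => (f 0 : ℝ≥0∞) * F1 C f) atTop
      (nhds ((f 0 : ℝ≥0∞) * if Mx f < ∞ then Mx f / ∑' t, (f t : ℝ≥0∞) else 0)) := by
  by_cases h0 : f 0 = 0
  · simp [h0]
  refine ENNReal.Tendsto.const_mul ?_ (Or.inr ENNReal.coe_ne_top)
  unfold F1
  split_ifs with hM
  · refine ENNReal.Tendsto.div ?_ ?_ ?_ ?_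
    · have : Tendsto (fun C => mC C f) atTop (nhds (⨆ C, mC C f)) :=
        tendsto_atTop_iSup (fun C D hCD => Finset.sup_mono hCD)
      rwa [show (⨆ C, mC C f) = Mx f from
        le_antisymm (iSup_le fun C => Finset.sup_le fun t _ => le_iSup (fun t => (f t : ℝ≥0∞)) t)
          (iSup_le fun t => le_iSup_of_le {t} (by simp [mC]))] at this
    · right
      intro h
      rw [ENNReal.tsum_eq_zero] at h
      exact h0 (by simpa using h 0)
    · exact ENNReal.summable.hasSum
    · right; exact hM.ne
  · exact tendsto_const_nhds

lemma tendsto_F2 {d : ℕ} (f : Fld d) :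
    Tendsto (fun C => (f 0 : ℝ≥0∞) * F2 C 0 f) atTop (nhds 0) := by
  refine tendsto_const_nhds.congr' ?_
  by_cases hM : Mx f = ∞
  · have : (f 0 : ℝ≥0∞) < Mx f := by rw [hM]; exact ENNReal.coe_lt_top
    obtain ⟨s, hs⟩ := lt_iSup_iff.1 this
    filter_upwards [eventually_ge_atTop {s}] with C hC
    have : ¬ ∀ t ∈ C, f t ≤ f 0 := fun H =>
      absurd (H s (hC (by simp))) (not_le.2 (by exact_mod_cast hs))
    simp [F2, this]
  · simp [F2, hM]

lemma exists_box {d : ℕ} (S : Finset (Idx d)) : ∃ R : ℕ, ∀ s ∈ S, ∀ j, |s j| ≤ (R : ℤ) := by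
  refine ⟨∑ s ∈ S, ∑ j, (s j).natAbs, fun s hs j => ?_⟩
  rw [Int.abs_eq_natAbs]
  have h1 : (s j).natAbs ≤ ∑ j, (s j).natAbs :=
    Finset.single_le_sum (f := fun j => (s j).natAbs) (by simp) (Finset.mem_univ j)
  have h2 : ∑ j, (s j).natAbs ≤ ∑ s ∈ S, ∑ j, (s j).natAbs :=
    Finset.single_le_sum (f := fun s : Idx d => ∑ j, (s j).natAbs) (by simp) hs
  exact_mod_cast h1.trans h2

lemma tendsto_ratio (d : ℕ) (a : ℝ) :
    Tendsto (fun n : ℕ => ((n : ℝ) + a) ^ d / (n : ℝ) ^ d) atTop (nhds 1) := by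
  have h : Tendsto (fun n : ℕ => (1 + a / (n : ℝ)) ^ d) atTop (nhds 1) := by
    have := ((tendsto_const_div_atTop_nhds_zero_nat a).const_add 1).pow d
    simpa using this
  refine h.congr' ?_
  filter_upwards [eventually_gt_atTop 0] with n hn
  have : (n : ℝ) ≠ 0 := by positivity
  rw [← div_pow]
  congr 1
  field_simp

lemma cesaro_real {d : ℕ} (b : Finset (Idx d) → ℝ) (l : ℝ) (hl : |l| ≤ 1)
    (hb : ∀ C, 0 ≤ b C ∧ b C ≤ 1) (hl0 : 0 ≤ l)
    (h : Tendsto b atTop (nhds l)) :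
    Tendsto (fun n : ℕ => (∑ h ∈ cubeF d n, b (subF (cubeF d n) h)) / (n : ℝ) ^ d) atTop
      (nhds l) := by
  have hc : ∀ n : ℕ, ((cubeF d n).card : ℝ) = ((n : ℝ) + 1) ^ d := by
    intro n
    rw [cubeF, card_box]
    have : ((n : ℤ) + 1 - 0).toNat = n + 1 := by omega
    rw [this]; push_cast; rfl
  have key : Tendsto (fun n : ℕ => (∑ h ∈ cubeF d n, b (subF (cubeF d n) h)) / (n : ℝ) ^ d
      - l * (((n : ℝ) + 1) ^ d / (n : ℝ) ^ d)) atTop (nhds 0) := by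
    rw [Metric.tendsto_atTop']
    intro ε hε
    have h' := (Metric.tendsto_nhds.1 h) (ε / 4) (by positivity)
    obtain ⟨S, hS⟩ := eventually_atTop.1 h'
    obtain ⟨R, hR⟩ := exists_box S
    have t1 := tendsto_ratio d 1
    have t2 := t1.sub (tendsto_ratio d (1 - 2 * R))
    rw [sub_self] at t2
    have e1 : ∀ᶠ n : ℕ in atTop, ((n : ℝ) + 1) ^ d / (n : ℝ) ^ d < 2 :=
      t1.eventually_lt_const (by norm_num)
    have e2 := t2.eventually_lt_const (show (0 : ℝ) < ε / 2 by positivity)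
    have e3 := (e1.and e2).and (eventually_gt_atTop (2 * R + 1))
    obtain ⟨N, hN⟩ := eventually_atTop.1 e3
    refine ⟨N, fun n hn => ?_⟩
    obtain ⟨⟨h1, h2⟩, h3⟩ := hN n hn.le
    have hnpos : (0 : ℝ) < (n : ℝ) ^ d := by
      have : 0 < n := by omega
      positivity
    set G : Finset (Idx d) := Finset.Icc (fun _ => (R : ℤ)) (fun _ => (n : ℤ) - R) with hG
    have hGc : (G.card : ℝ) = ((n : ℝ) + (1 - 2 * R)) ^ d := by
      rw [hG, card_box]
      have h4 : ((n : ℤ) - R + 1 - R).toNat = n + 1 - 2 * R := by omega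
      rw [h4]
      push_cast [Nat.cast_sub (show 2 * R ≤ n + 1 by omega)]
      congr 1; ring
    have hGC : G ⊆ cubeF d n := by
      apply Finset.Icc_subset_Icc
      · intro j; simp
      · intro j; simp
    have hgood : ∀ h ∈ G, |b (subF (cubeF d n) h) - l| ≤ ε / 4 := by
      intro h hh
      have : S ≤ subF (cubeF d n) h := by
        intro s hs
        rw [mem_subF, cubeF, Finset.mem_Icc]
        rw [hG, Finset.mem_Icc] at hh
        constructor
        · intro j
          have := abs_le.1 (hR s hs j)
          have h5 := hh.1 j
          simp only [Pi.add_apply] at *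
          linarith
        · intro j
          have := abs_le.1 (hR s hs j)
          have h5 := hh.2 j
          simp only [Pi.add_apply] at *
          linarith
      exact (hS _ this).le
    have hbad : ∀ h, |b (subF (cubeF d n) h) - l| ≤ 1 := by
      intro h
      have := hb (subF (cubeF d n) h)
      rw [abs_le] at hl ⊢
      constructor <;> linarith [this.1, this.2, hl.2]
    have hsum : |∑ h ∈ cubeF d n, (b (subF (cubeF d n) h) - l)| ≤
        ((n : ℝ) + 1) ^ d * (ε / 4) + (((n : ℝ) + 1) ^ d - ((n : ℝ) + (1 - 2 * R)) ^ d) := by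
      refine (Finset.abs_sum_le_sum_abs _ _).trans ?_
      rw [← Finset.sum_sdiff hGC]
      have g1 : ∑ h ∈ G, |b (subF (cubeF d n) h) - l| ≤ G.card * (ε / 4) := by
        have := Finset.sum_le_card_nsmul G _ _ hgood
        simpa using this
      have g2 : ∑ h ∈ cubeF d n \ G, |b (subF (cubeF d n) h) - l| ≤
          ((cubeF d n \ G).card : ℝ) := by
        have := Finset.sum_le_card_nsmul (cubeF d n \ G) _ 1 (fun h _ => hbad h)
        simpa using this
      have g3 : ((cubeF d n \ G).card : ℝ) = (cubeF d n).card - G.card := by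
        rw [Finset.card_sdiff_of_subset hGC, Nat.cast_sub (Finset.card_le_card hGC)]
      have g4 : (G.card : ℝ) ≤ (cubeF d n).card := by
        exact_mod_cast Finset.card_le_card hGC
      rw [g3] at g2
      have g5 : (G.card : ℝ) * (ε / 4) ≤ (cubeF d n).card * (ε / 4) := by gcongr
      rw [← hGc, ← hc n]
      linarith
    rw [Finset.sum_sub_distrib, Finset.sum_const, nsmul_eq_mul, hc n] at hsum
    rw [Real.dist_eq, sub_zero]
    have : (∑ h ∈ cubeF d n, b (subF (cubeF d n) h)) / (n : ℝ) ^ d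
      - l * (((n : ℝ) + 1) ^ d / (n : ℝ) ^ d) =
      (∑ h ∈ cubeF d n, b (subF (cubeF d n) h) - ((n : ℝ) + 1) ^ d * l) / (n : ℝ) ^ d := by
      ring
    rw [this, abs_div, abs_of_pos hnpos]
    calc _ ≤ (((n : ℝ) + 1) ^ d * (ε / 4) +
          (((n : ℝ) + 1) ^ d - ((n : ℝ) + (1 - 2 * R)) ^ d)) / (n : ℝ) ^ d := by gcongr
      _ = (((n : ℝ) + 1) ^ d / (n : ℝ) ^ d) * (ε / 4) + (((n : ℝ) + 1) ^ d / (n : ℝ) ^ d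
          - ((n : ℝ) + (1 - 2 * R)) ^ d / (n : ℝ) ^ d) := by ring
      _ < ε := by nlinarith
  have t1 := (tendsto_ratio d 1).const_mul l
  have := key.add t1
  simpa using this

lemma cesaro {d : ℕ} (a : Finset (Idx d) → ℝ≥0∞) (l : ℝ≥0∞)
    (ha : ∀ C, a C ≤ 1) (h : Tendsto a atTop (nhds l)) :
    Tendsto (fun n : ℕ => (∑ h ∈ cubeF d n, a (subF (cubeF d n) h)) / (n : ℝ≥0∞) ^ d) atTop
      (nhds l) := by
  have hl : l ≤ 1 := le_of_tendsto' h ha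
  have hlt : l ≠ ∞ := (hl.trans_lt one_lt_top).ne
  have hat : ∀ C, a C ≠ ∞ := fun C => ((ha C).trans_lt one_lt_top).ne
  have hlr : l.toReal ≤ 1 := by simpa using ENNReal.toReal_mono one_ne_top hl
  have := cesaro_real (fun C => (a C).toReal) l.toReal
    (by rw [abs_of_nonneg toReal_nonneg]; exact hlr)
    (fun C => ⟨toReal_nonneg, by simpa using ENNReal.toReal_mono one_ne_top (ha C)⟩)
    toReal_nonneg ((ENNReal.tendsto_toReal hlt).comp h)
  have h2 := ENNReal.tendsto_ofReal this
  rw [ENNReal.ofReal_toReal hlt] at h2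
  refine h2.congr' ?_
  filter_upwards [eventually_gt_atTop 0] with n hn
  have hnpos : (0 : ℝ) < (n : ℝ) ^ d := by positivity
  rw [ENNReal.ofReal_div_of_pos hnpos, ← ENNReal.toReal_sum (fun h _ => hat _),
    ENNReal.ofReal_toReal (ENNReal.sum_ne_top.2 fun h _ => hat _),
    ENNReal.ofReal_pow (by positivity), ENNReal.ofReal_natCast]

end Aux

/-- For `Z` Brown–Resnick stationary with `E[Z(t)] = 1`,
`max_t Z(t) > 0` a.s. and `P(Σ_t Z(t) < ∞) > 0`, the classical extremal index
`H_Z = lim n^{-d} E[max_{t∈{0,…,n}^d} Z(t)]` equals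
`E[ Z(0) · (max_t Z(t) / Σ_t Z(t)) · 1{Σ_t Z(t) < ∞} ]`. -/
theorem stmt6 {d : ℕ} (hd : 0 < d) {Ω : Type*} [MeasurableSpace Ω] (P : Measure Ω)
    [IsProbabilityMeasure P] (Z : Ω → Fld d) (hZ : IsBRS P Z)
    (hZpos : ∀ᵐ ω ∂P, ∃ t, 0 < Z ω t)
    (hsum : 0 < P {ω | ∑' t : Idx d, (Z ω t : ℝ≥0∞) < ∞})
    (H : ℝ≥0∞)
    (hH : Tendsto (fun n : ℕ => cubeMaxExp P Z n / (n : ℝ≥0∞) ^ d) atTop (nhds H)) :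
    H = ∫⁻ ω in {ω | ∑' t : Idx d, (Z ω t : ℝ≥0∞) < ∞},
          (Z ω 0 : ℝ≥0∞) *
            ((⨆ t : Idx d, (Z ω t : ℝ≥0∞)) / ∑' t : Idx d, (Z ω t : ℝ≥0∞)) ∂P := by
  classical
  have hm := hZ.meas
  have hm0 : Measurable fun ω => (Z ω 0 : ℝ≥0∞) := (meas_coe 0).comp hm
  set S : Set Ω := {ω | ∑' t : Idx d, (Z ω t : ℝ≥0∞) < ∞} with hSdef
  have hS : MeasurableSet S := by
    refine measurableSet_lt ?_ measurable_const
    exact Measurable.tsum fun t => (meas_coe t).comp hm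
  set a1 : Finset (Idx d) → ℝ≥0∞ := fun C => ∫⁻ ω, (Z ω 0 : ℝ≥0∞) * F1 C (Z ω) ∂P with ha1
  set a2 : Finset (Idx d) → ℝ≥0∞ := fun C => ∫⁻ ω, (Z ω 0 : ℝ≥0∞) * F2 C 0 (Z ω) ∂P with ha2
  set l : ℝ≥0∞ := ∫⁻ ω, (Z ω 0 : ℝ≥0∞) *
    (if Mx (Z ω) < ∞ then Mx (Z ω) / ∑' t, (Z ω t : ℝ≥0∞) else 0) ∂P with hl
  have hfin : ∫⁻ ω, (Z ω 0 : ℝ≥0∞) ∂P ≠ ∞ := by rw [hZ.mean_one]; simp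
  have t1 : Tendsto a1 atTop (nhds l) := by
    refine tendsto_lintegral_filter_of_dominated_convergence (fun ω => (Z ω 0 : ℝ≥0∞)) ?_ ?_
      hfin ?_
    · exact Eventually.of_forall fun C => hm0.mul ((meas_F1 C).comp hm)
    · exact Eventually.of_forall fun C => Eventually.of_forall fun ω =>
        mul_le_of_le_one_right bot_le (F1_le C _)
    · exact Eventually.of_forall fun ω => tendsto_F1 (Z ω)
  have t2 : Tendsto a2 atTop (nhds 0) := by
    have : Tendsto a2 atTop (nhds (∫⁻ ω, 0 ∂P)) := by
      refine tendsto_lintegral_filter_of_dominated_convergence (fun ω => (Z ω 0 : ℝ≥0∞)) ?_ ?_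
        hfin ?_
      · exact Eventually.of_forall fun C => hm0.mul ((meas_F2 C 0).comp hm)
      · exact Eventually.of_forall fun C => Eventually.of_forall fun ω =>
          mul_le_of_le_one_right bot_le (F2_le C 0 _)
      · exact Eventually.of_forall fun ω => tendsto_F2 (Z ω)
    simpa using this
  have b1 : ∀ C, a1 C ≤ 1 := fun C => by
    rw [← hZ.mean_one 0]
    exact lintegral_mono fun ω => mul_le_of_le_one_right bot_le (F1_le C _)
  have b2 : ∀ C, a2 C ≤ 1 := fun C => by
    rw [← hZ.mean_one 0]
    exact lintegral_mono fun ω => mul_le_of_le_one_right bot_le (F2_le C 0 _)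
  have c1 := cesaro a1 l b1 t1
  have c2 := cesaro a2 0 b2 t2
  have s1 : ∀ n, ∑ h ∈ cubeF d n, a1 (subF (cubeF d n) h) =
      ∫⁻ ω, (if Mx (Z ω) < ∞ then mC (cubeF d n) (Z ω) else 0) ∂P := by
    intro n
    simp_rw [← sum_F1]
    have hmm : ∀ h ∈ cubeF d n, Measurable fun ω => (Z ω h : ℝ≥0∞) * F1 (cubeF d n) (Z ω) :=
      fun h _ => ((meas_coe h).comp hm).mul ((meas_F1 _).comp hm)
    rw [lintegral_finsetSum _ hmm]
    refine Finset.sum_congr rfl fun h _ => ?_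
    rw [hZ.tilt_shift h _ (meas_F1 _) (F1_homog _)]
    simp_rw [F1_shift, ha1]
  have s2 : ∀ n, ∫⁻ ω, (if Mx (Z ω) < ∞ then 0 else mC (cubeF d n) (Z ω)) ∂P ≤
      ∑ h ∈ cubeF d n, a2 (subF (cubeF d n) h) := by
    intro n
    have hne : (cubeF d n).Nonempty := ⟨fun _ => 0, by rw [mem_cubeF]; simp [cube]⟩
    refine (lintegral_mono fun ω => sum_F2 (cubeF d n) hne (Z ω)).trans ?_
    have hmm : ∀ h ∈ cubeF d n, Measurable fun ω => (Z ω h : ℝ≥0∞) * F2 (cubeF d n) h (Z ω) :=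
      fun h _ => ((meas_coe h).comp hm).mul ((meas_F2 _ _).comp hm)
    rw [lintegral_finsetSum _ hmm]
    refine Finset.sum_le_sum fun h _ => ?_
    rw [hZ.tilt_shift h _ (meas_F2 _ _) (F2_homog _ _)]
    simp_rw [F2_shift, ha2]
    exact le_rfl
  have hmax : ∀ n, cubeMaxExp P Z n = ∫⁻ ω, mC (cubeF d n) (Z ω) ∂P := by
    intro n
    unfold cubeMaxExp
    refine lintegral_congr fun ω => ?_
    simp only [mC, Finset.sup_eq_iSup, mem_cubeF]
  have hlow : l ≤ H := by
    refine le_of_tendsto_of_tendsto' c1 hH fun n => ?_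
    rw [s1, hmax]
    gcongr
    split_ifs <;> simp
  have hup : H ≤ l := by
    have c3 := c1.add c2
    rw [add_zero] at c3
    refine le_of_tendsto_of_tendsto' hH c3 fun n => ?_
    rw [← ENNReal.add_div, s1, hmax]
    gcongr
    refine le_trans (le_of_eq ?_) (add_le_add_right (s2 n) _)
    rw [← lintegral_add_left]
    · refine lintegral_congr fun ω => ?_
      split_ifs <;> simp
    · exact Measurable.ite (measurableSet_lt (meas_Mx.comp hm) measurable_const)
        ((meas_mC _).comp hm) measurable_const
  rw [le_antisymm hup hlow, hl, ← lintegral_indicator hS]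
  refine lintegral_congr fun ω => ?_
  by_cases hω : ω ∈ S
  · rw [Set.indicator_of_mem hω]
    have : Mx (Z ω) < ∞ := lt_of_le_of_lt (iSup_le fun t => ENNReal.le_tsum t) hω
    rw [if_pos this]
    rfl
  · rw [Set.indicator_of_notMem hω]
    have : ∑' t : Idx d, (Z ω t : ℝ≥0∞) = ∞ := by simpa [hSdef] using hω
    simp [this]
end
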